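/- Assume there is a constant C > 0 such that for all s ≥ 1, |y₀(s) − √(2/(πs))·cos(s − π/4)| ≤ C·s^{−3/2} and |y₁(s) − √(2/(πs))·sin(s − π/4)| ≤ C·s^{−3/2}. Then for every continuous compactly supported f : ℝ² → ℝ, lim_{N→∞} ∬_{ℝ²} f(τ,θ)·(∂P_N/∂τ (τ,θ))² dτ dθ = (A²/(2π))·∬_{ℝ²} f(τ,θ)·e^{−τ} dτ dθ. That is, the weak limit of (∂_τ P_N)² is A²·e^{−τ}/(2π). -/

import Mathlib

/-- The Gowdy wave `P_N(τ,θ) = (A/√N)·y₀(N·e^{−τ})·sin(N·θ)` (in the paper `y₀ = J₀`). -/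
noncomputable def P_N (A : ℝ) (y₀ : ℝ → ℝ) (N : ℕ) (τ θ : ℝ) : ℝ :=
  (A / Real.sqrt N) * y₀ ((N : ℝ) * Real.exp (-τ)) * Real.sin ((N : ℝ) * θ)

open Filter MeasureTheory

lemma aux_err (C : ℝ) (hC : 0 < C) (y₁ : ℝ → ℝ)
    (h1 : ∀ s : ℝ, 1 ≤ s →
      |y₁ s - Real.sqrt (2 / (Real.pi * s)) * Real.sin (s - Real.pi / 4)|
        ≤ C * s ^ (-(3:ℝ)/2)) (s : ℝ) (hs : 1 ≤ s) :
    |s * y₁ s ^ 2 - (1 / Real.pi) * (1 - Real.sin (2 * s))| ≤ C * (2 + C) / s := by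
  have hs0 : 0 < s := by linarith
  have hpi := Real.pi_pos
  have hq : 0 < Real.sqrt s := Real.sqrt_pos.2 hs0
  have hqq : Real.sqrt s * Real.sqrt s = s := Real.mul_self_sqrt hs0.le
  set b := Real.sqrt (2 / Real.pi) * Real.sin (s - Real.pi / 4) with hb
  set a := Real.sqrt s * y₁ s with ha
  have hsq : Real.sqrt (2 / (Real.pi * s)) = Real.sqrt (2 / Real.pi) / Real.sqrt s := by
    rw [← Real.sqrt_div (by positivity), div_div]
  have hpow : Real.sqrt s * s ^ (-(3:ℝ)/2) = 1 / s := by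
    rw [Real.sqrt_eq_rpow, ← Real.rpow_add hs0]
    norm_num
    rw [Real.rpow_neg_one]
  have hab : |a - b| ≤ C / s := by
    have e : a - b = Real.sqrt s *
        (y₁ s - Real.sqrt (2 / (Real.pi * s)) * Real.sin (s - Real.pi / 4)) := by
      rw [hsq, ha, hb]; field_simp
    rw [e, abs_mul, abs_of_pos hq]
    calc _ ≤ Real.sqrt s * (C * s ^ (-(3:ℝ)/2)) := by gcongr; exact h1 s hs
      _ = C * (Real.sqrt s * s ^ (-(3:ℝ)/2)) := by ring
      _ = C / s := by rw [hpow]; ring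
  have hb1 : |b| ≤ 1 := by
    rw [hb, abs_mul, abs_of_nonneg (Real.sqrt_nonneg _)]
    have : Real.sqrt (2 / Real.pi) ≤ 1 := by
      rw [Real.sqrt_le_iff, one_pow, div_le_one hpi]; exact ⟨zero_le_one, by linarith [Real.pi_gt_three]⟩
    exact mul_le_one₀ this (abs_nonneg _) (Real.abs_sin_le_one _)
  have hCs : C / s ≤ C := div_le_self hC.le hs
  have hsum : |a + b| ≤ 2 + C := by
    have e : a + b = (a - b) + b + b := by ring
    rw [e]
    have := abs_add_le (a - b + b) b
    have := abs_add_le (a - b) b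
    linarith
  have hb2 : b ^ 2 = (1 / Real.pi) * (1 - Real.sin (2 * s)) := by
    rw [hb, mul_pow, Real.sq_sqrt (by positivity), Real.sin_sq_eq_half_sub]
    have : 2 * (s - Real.pi / 4) = 2 * s - Real.pi / 2 := by ring
    rw [this, Real.cos_sub_pi_div_two]; ring
  have ha2 : a ^ 2 = s * y₁ s ^ 2 := by rw [ha, mul_pow, Real.sq_sqrt hs0.le]
  rw [← hb2, ← ha2]
  have e : a ^ 2 - b ^ 2 = (a - b) * (a + b) := by ring
  rw [e, abs_mul]
  calc _ ≤ C / s * (2 + C) := by gcongr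
    _ = _ := by ring

lemma aux_w : Tendsto (fun N : ℕ => (N : ℝ) / Real.pi) atTop (cocompact ℝ) :=
  ((tendsto_natCast_atTop_atTop (R := ℝ)).atTop_div_const Real.pi_pos).mono_right
    atTop_le_cocompact

lemma aux_char (N : ℕ) (u : ℝ) :
    ((Real.fourierChar (-(u * ((N : ℝ) / Real.pi))) : Circle) : ℂ)
      = Real.cos (2 * (N * u)) - Real.sin (2 * (N * u)) * Complex.I := by
  rw [Real.fourierChar_apply]
  have hpi := Real.pi_pos.ne'
  have : 2 * Real.pi * -(u * ((N : ℝ) / Real.pi)) = -(2 * (N * u)) := by field_simp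
  rw [this, Complex.exp_mul_I, ← Complex.ofReal_cos, ← Complex.ofReal_sin, Real.cos_neg,
    Real.sin_neg]
  push_cast; ring

lemma aux_cos (h : ℝ → ℝ) (hh : Continuous h) (hc : HasCompactSupport h) :
    Tendsto (fun N : ℕ => ∫ θ, h θ * Real.cos (2 * (N * θ))) atTop (nhds 0) := by
  have := (Real.tendsto_integral_exp_smul_cocompact (fun x => (h x : ℂ))).comp aux_w
  have := (Complex.continuous_re.tendsto _).comp this
  simp only [Complex.zero_re] at this
  refine this.congr fun N => ?_
  simp only [Function.comp]
  have e : ∀ v, Real.fourierChar (-(v * ((N : ℝ) / Real.pi))) • (h v : ℂ)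
      = (Real.cos (2 * (N * v)) - Real.sin (2 * (N * v)) * Complex.I) * (h v : ℂ) := fun v => by
    rw [Circle.smul_def, aux_char, smul_eq_mul]
  simp only [e]
  have hi : Integrable (fun v : ℝ =>
      ((Real.cos (2 * (N * v)) - Real.sin (2 * (N * v)) * Complex.I) * (h v : ℂ))) := by
    apply Continuous.integrable_of_hasCompactSupport
    · fun_prop
    · exact (hc.comp_left (g := fun x : ℝ => (x : ℂ)) (by simp)).mul_left
  have := integral_re hi
  simp only [RCLike.re_to_complex] at this
  rw [← this]
  congr 1; ext v
  simp [-Complex.ofReal_cos, -Complex.ofReal_sin]; ring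

lemma aux_sin (h : ℝ → ℝ) (hh : Continuous h) (hc : HasCompactSupport h) :
    Tendsto (fun N : ℕ => ∫ τ, h τ * Real.exp (-τ) * Real.sin (2 * (N * Real.exp (-τ))))
      atTop (nhds 0) := by
  have := (Real.tendsto_integral_exp_smul_cocompact
    ((Set.Ioi (0:ℝ)).indicator (fun x => (h (-Real.log x) : ℂ)))).comp aux_w
  have := ((Complex.continuous_im.tendsto _).comp this).neg
  simp only [Complex.zero_im, neg_zero] at this
  refine this.congr fun N => ?_
  simp only [Function.comp]
  have e : ∀ v, Real.fourierChar (-(v * ((N : ℝ) / Real.pi))) •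
        ((Set.Ioi (0:ℝ)).indicator (fun x => (h (-Real.log x) : ℂ)) v)
      = (Set.Ioi (0:ℝ)).indicator (fun v => 
        (Real.cos (2 * (N * v)) - Real.sin (2 * (N * v)) * Complex.I) *
          (h (-Real.log v) : ℂ)) v := fun v => by
    rw [Circle.smul_def, aux_char, smul_eq_mul]
    by_cases hv : v ∈ Set.Ioi (0:ℝ) <;> simp only [Set.indicator, hv, if_true, if_false, mul_zero]
  simp only [e]
  rw [integral_indicator measurableSet_Ioi]
  have him : (fun τ : ℝ => Real.exp (-τ)) '' Set.univ = Set.Ioi 0 := by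
    ext x
    constructor
    · rintro ⟨t, -, rfl⟩; exact Real.exp_pos _
    · intro hx
      exact ⟨-Real.log x, trivial, by simp [Real.exp_log hx]⟩
  have hcv := integral_image_eq_integral_abs_deriv_smul (f := fun τ : ℝ => Real.exp (-τ))
    (f' := fun τ => -Real.exp (-τ)) MeasurableSet.univ
    (fun x _ => by
      have h : HasDerivAt (fun τ : ℝ => Real.exp (-τ)) (-Real.exp (-x)) x := by
        simpa using (hasDerivAt_neg x).exp
      exact h.hasDerivWithinAt)
    (fun x _ y _ hxy => by simpa using hxy)
    (fun v : ℝ => (Real.cos (2 * (N * v)) - Real.sin (2 * (N * v)) * Complex.I) *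
          (h (-Real.log v) : ℂ))
  rw [him] at hcv
  rw [hcv]
  simp only [Measure.restrict_univ, abs_neg, Real.abs_exp, Real.log_exp, neg_neg]
  have hi : Integrable (fun x : ℝ => Real.exp (-x) •
      ((Real.cos (2 * (N * Real.exp (-x))) - Real.sin (2 * (N * Real.exp (-x))) * Complex.I)
        * (h x : ℂ))) := by
    apply Continuous.integrable_of_hasCompactSupport
    · fun_prop
    · refine hc.mono fun x hx h0 => hx ?_
      simp only [h0, Complex.ofReal_zero, mul_zero, smul_zero]
  have := integral_im hi
  simp only [RCLike.im_to_complex] at this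
  rw [← this, ← integral_neg]
  congr 1; ext v
  simp [-Complex.ofReal_cos, -Complex.ofReal_sin, -Complex.ofReal_exp, Complex.smul_im]; ring

lemma aux_prod (F : ℝ × ℝ → ℝ) (hF : Continuous F) (hc : HasCompactSupport F)
    (b k : ℕ → ℝ → ℝ) (hb : ∀ N, Continuous (b N)) (hk : ∀ N, Continuous (k N))
    (hb1 : ∀ N x, |b N x| ≤ 1) (hk1 : ∀ N x, |k N x| ≤ 1)
    (hlim : ∀ x, Tendsto (fun N => ∫ y, F (x, y) * k N y) atTop (nhds 0)) :
    Tendsto (fun N => ∫ p : ℝ × ℝ, F p * (b N p.1 * k N p.2)) atTop (nhds 0) := by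
  have hFi : Integrable F (volume.prod volume) := hF.integrable_of_hasCompactSupport hc
  have hi : ∀ N, Integrable (fun p : ℝ × ℝ => F p * (b N p.1 * k N p.2))
      (volume.prod volume) := fun N => by
    apply Continuous.integrable_of_hasCompactSupport
    · have := hb N; have := hk N; fun_prop
    · exact hc.mul_right
  have e : ∀ N, ∫ p : ℝ × ℝ, F p * (b N p.1 * k N p.2)
      = ∫ x, b N x * ∫ y, F (x, y) * k N y := fun N => by
    rw [Measure.volume_eq_prod, integral_prod _ (hi N)]
    congr 1; ext x
    rw [← integral_const_mul]
    congr 1; ext y; ring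
  simp only [e]
  have h0 : (0:ℝ) = ∫ _x : ℝ, (0:ℝ) := by simp
  rw [h0]
  refine tendsto_integral_of_dominated_convergence (fun x => ∫ y, ‖F (x, y)‖) ?_ 
    hFi.integral_norm_prod_left ?_ ?_
  · intro N
    have := (hi N).integral_prod_left.aestronglyMeasurable
    refine this.congr (ae_of_all _ fun x => ?_)
    simp only
    rw [← integral_const_mul]
    congr 1; ext y; ring
  · intro N
    filter_upwards [hFi.prod_right_ae] with x hx
    rw [norm_mul]
    calc _ ≤ 1 * ‖∫ y, F (x, y) * k N y‖ := by gcongr; exact hb1 N x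
      _ ≤ ∫ y, ‖F (x, y)‖ := by
        rw [one_mul]
        refine norm_integral_le_of_norm_le hx.norm (ae_of_all _ fun y => ?_)
        rw [norm_mul]
        exact mul_le_of_le_one_right (norm_nonneg _) (hk1 N y)
  · refine ae_of_all _ fun x => ?_
    have : Tendsto (fun N => ‖∫ y, F (x, y) * k N y‖) atTop (nhds 0) := by
      simpa using (hlim x).norm
    refine squeeze_zero_norm (fun N => ?_) this
    rw [norm_mul]
    exact mul_le_of_le_one_left (norm_nonneg _) (hb1 N x)

lemma aux_slice (F : ℝ × ℝ → ℝ) (hc : HasCompactSupport F) (x : ℝ) :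
    HasCompactSupport (fun y => F (x, y)) := by
  refine HasCompactSupport.of_support_subset_isCompact
    (K := Prod.snd '' tsupport F) (hc.isCompact.image continuous_snd) ?_
  intro y hy
  exact ⟨(x, y), subset_tsupport _ hy, rfl⟩

lemma aux_slice' (F : ℝ × ℝ → ℝ) (hc : HasCompactSupport F) (y : ℝ) :
    HasCompactSupport (fun x => F (x, y)) := by
  refine HasCompactSupport.of_support_subset_isCompact
    (K := Prod.fst '' tsupport F) (hc.isCompact.image continuous_fst) ?_
  intro x hx
  exact ⟨(x, y), subset_tsupport _ hx, rfl⟩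

lemma aux_T1 (f : ℝ × ℝ → ℝ) (hf : Continuous f) (hc : HasCompactSupport f) :
    Tendsto (fun N : ℕ => ∫ p : ℝ × ℝ, f p * Real.exp (-p.1) * Real.cos (2 * (N * p.2)))
      atTop (nhds 0) := by
  have := aux_prod (fun p => f p * Real.exp (-p.1)) (by fun_prop) hc.mul_right
    (fun _ _ => 1) (fun N y => Real.cos (2 * (N * y))) (fun _ => by fun_prop)
    (fun _ => by fun_prop) (fun _ _ => by simp) (fun _ _ => Real.abs_cos_le_one _)
    (fun x => aux_cos (fun y => f (x, y) * Real.exp (-x)) (by fun_prop)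
      (aux_slice f hc x).mul_right)
  simpa using this

lemma aux_T2 (f : ℝ × ℝ → ℝ) (hf : Continuous f) (hc : HasCompactSupport f)
    (b : ℕ → ℝ → ℝ) (hb : ∀ N, Continuous (b N)) (hb1 : ∀ N x, |b N x| ≤ 1) :
    Tendsto (fun N : ℕ => ∫ p : ℝ × ℝ, f p * Real.exp (-p.1) *
      (b N p.2 * Real.sin (2 * (N * Real.exp (-p.1))))) atTop (nhds 0) := by
  have := aux_prod (fun p => f p.swap * Real.exp (-p.2)) (by fun_prop)
    ((hc.comp_homeomorph (Homeomorph.prodComm ℝ ℝ)).mul_right)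
    b (fun N y => Real.sin (2 * (N * Real.exp (-y)))) hb
    (fun _ => by fun_prop) hb1 (fun _ _ => Real.abs_sin_le_one _)
    (fun x => aux_sin (fun y => f (y, x)) (by fun_prop) (aux_slice' f hc x))
  refine this.congr fun N => ?_
  rw [Measure.volume_eq_prod, ← integral_prod_swap]
  rfl

lemma aux_deriv (A : ℝ) (y₀ y₁ : ℝ → ℝ)
    (hy₀ : ∀ s > (0:ℝ), HasDerivAt y₀ (-y₁ s) s) (N : ℕ) (hN : 0 < N) (τ θ : ℝ) :
    (deriv (fun t : ℝ => P_N A y₀ N t θ) τ) ^ 2 =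
      A ^ 2 * Real.exp (-τ) * ((N * Real.exp (-τ)) * y₁ (N * Real.exp (-τ)) ^ 2)
        * Real.sin (N * θ) ^ 2 := by
  have hN' : (0:ℝ) < N := by exact_mod_cast hN
  have h1 : HasDerivAt (fun t : ℝ => (N:ℝ) * Real.exp (-t)) (-(N * Real.exp (-τ))) τ := by
    simpa using ((hasDerivAt_neg τ).exp).const_mul (N:ℝ)
  have h2 := (hy₀ (N * Real.exp (-τ)) (by positivity)).comp τ h1
  have h3 := (h2.const_mul (A / Real.sqrt N)).mul_const (Real.sin (N * θ))
  have h4 : HasDerivAt (fun t : ℝ => P_N A y₀ N t θ) _ τ := h3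
  rw [h4.deriv]
  have hq : Real.sqrt N ^ 2 = N := Real.sq_sqrt hN'.le
  simp only [mul_pow, div_pow, hq]
  field_simp

/-- Under the standard large-argument Bessel asymptotics for `y₀, y₁`
(and `y₀′ = −y₁`), the weak limit of `(∂_τ P_N)²` is `A²·e^{−τ}/(2π)`: for every
continuous compactly supported `f : ℝ² → ℝ`,
`∬ f·(∂P_N/∂τ)² → (A²/(2π))·∬ f·e^{−τ}` as `N → ∞`. -/
theorem wlim_dtau_P_N_sq (A C : ℝ) (hA : 0 < A) (hC : 0 < C) (y₀ y₁ : ℝ → ℝ)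
    (hy₀ : ∀ s > (0:ℝ), HasDerivAt y₀ (-y₁ s) s)
    (h0 : ∀ s : ℝ, 1 ≤ s →
      |y₀ s - Real.sqrt (2 / (Real.pi * s)) * Real.cos (s - Real.pi / 4)|
        ≤ C * s ^ (-(3:ℝ)/2))
    (h1 : ∀ s : ℝ, 1 ≤ s →
      |y₁ s - Real.sqrt (2 / (Real.pi * s)) * Real.sin (s - Real.pi / 4)|
        ≤ C * s ^ (-(3:ℝ)/2))
    (f : ℝ × ℝ → ℝ) (hf : Continuous f) (hsupp : HasCompactSupport f) :
    Tendsto (fun N : ℕ =>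
        ∫ p : ℝ × ℝ, f p * (deriv (fun t : ℝ => P_N A y₀ N t p.2) p.1) ^ 2)
      atTop (nhds ((A ^ 2 / (2 * Real.pi)) * ∫ p : ℝ × ℝ, f p * Real.exp (-p.1))) := by
  have hM : Tendsto (fun N : ℕ => ∫ p : ℝ × ℝ, f p * (A ^ 2 * Real.exp (-p.1) *
      ((1 / Real.pi) * (1 - Real.sin (2 * (N * Real.exp (-p.1))))) * Real.sin (N * p.2) ^ 2))
      atTop (nhds ((A ^ 2 / (2 * Real.pi)) * ∫ p : ℝ × ℝ, f p * Real.exp (-p.1))) := by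
    have t1 := aux_T1 f hf hsupp
    have t2 := aux_T2 f hf hsupp (fun _ _ => 1) (fun _ => by fun_prop) (fun _ _ => by simp)
    have t3 := aux_T2 f hf hsupp (fun N y => Real.cos (2 * (N * y))) (fun _ => by fun_prop)
      (fun _ _ => Real.abs_cos_le_one _)
    have t := ((((tendsto_const_nhds (x := ∫ p : ℝ × ℝ, f p * Real.exp (-p.1))).sub t1).sub
      t2).add t3).const_mul (A ^ 2 / (2 * Real.pi))
    simp only [sub_zero, add_zero] at t
    refine t.congr fun N => ?_
    have i0 : Integrable (fun p : ℝ × ℝ => f p * Real.exp (-p.1)) :=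
      Continuous.integrable_of_hasCompactSupport (by fun_prop) hsupp.mul_right
    have i1 : Integrable (fun p : ℝ × ℝ => f p * Real.exp (-p.1) * Real.cos (2 * (N * p.2))) :=
      Continuous.integrable_of_hasCompactSupport (by fun_prop) hsupp.mul_right.mul_right
    have i2 : Integrable (fun p : ℝ × ℝ => f p * Real.exp (-p.1) *
        (1 * Real.sin (2 * (N * Real.exp (-p.1))))) :=
      Continuous.integrable_of_hasCompactSupport (by fun_prop) hsupp.mul_right.mul_right
    have i3 : Integrable (fun p : ℝ × ℝ => f p * Real.exp (-p.1) *
        (Real.cos (2 * (N * p.2)) * Real.sin (2 * (N * Real.exp (-p.1))))) :=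
      Continuous.integrable_of_hasCompactSupport (by fun_prop) hsupp.mul_right.mul_right
    rw [← integral_sub' i0 i1, ← integral_sub' (i0.sub i1) i2,
      ← integral_add' ((i0.sub i1).sub i2) i3,
      ← integral_const_mul]
    congr 1; ext p
    simp only [Pi.sub_apply, Pi.add_apply]
    rw [Real.sin_sq_eq_half_sub (N * p.2)]
    have := Real.pi_pos.ne'
    field_simp
    ring
  -- error term
  have hfi : Integrable f := hf.integrable_of_hasCompactSupport hsupp
  obtain ⟨R, hR⟩ : ∃ R : ℝ, ∀ p ∈ tsupport f, p.1 ≤ R := by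
    obtain ⟨R, hR⟩ := (hsupp.isCompact.image continuous_fst).bddAbove
    exact ⟨R, fun p hp => hR ⟨p, hp, rfl⟩⟩
  have hev : ∀ᶠ N : ℕ in atTop, 0 < N ∧ Real.exp R ≤ N :=
    (eventually_gt_atTop 0).and (tendsto_natCast_atTop_atTop.eventually_ge_atTop _)
  set K := A ^ 2 * (C * (2 + C)) with hK
  have hKlim : Tendsto (fun N : ℕ => K / N * ∫ p : ℝ × ℝ, ‖f p‖) atTop (nhds 0) := by
    simpa using (tendsto_const_div_atTop_nhds_zero_nat K).mul_const (∫ p : ℝ × ℝ, ‖f p‖)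
  have hdiff : Tendsto (fun N : ℕ =>
      (∫ p : ℝ × ℝ, f p * (deriv (fun t : ℝ => P_N A y₀ N t p.2) p.1) ^ 2) -
      ∫ p : ℝ × ℝ, f p * (A ^ 2 * Real.exp (-p.1) *
      ((1 / Real.pi) * (1 - Real.sin (2 * (N * Real.exp (-p.1))))) * Real.sin (N * p.2) ^ 2))
      atTop (nhds 0) := by
    refine squeeze_zero_norm' ?_ hKlim
    filter_upwards [hev] with N hN
    obtain ⟨hN0, hNR⟩ := hN
    have hN' : (0:ℝ) < N := by exact_mod_cast hN0
    have hpt : ∀ p : ℝ × ℝ, ‖f p * (deriv (fun t : ℝ => P_N A y₀ N t p.2) p.1) ^ 2 -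
        f p * (A ^ 2 * Real.exp (-p.1) * ((1 / Real.pi) *
        (1 - Real.sin (2 * (N * Real.exp (-p.1))))) * Real.sin (N * p.2) ^ 2)‖
        ≤ K / N * ‖f p‖ := by
      intro p
      by_cases hp : f p = 0
      · simp [hp]
      have hpR := hR p (subset_tsupport _ hp)
      have hs : 1 ≤ N * Real.exp (-p.1) := by
        calc (1:ℝ) = Real.exp p.1 * Real.exp (-p.1) := by rw [← Real.exp_add]; simp
          _ ≤ N * Real.exp (-p.1) := by
            gcongr
            exact (Real.exp_le_exp.2 hpR).trans hNR
      have he := aux_err C hC y₁ h1 _ hs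
      rw [aux_deriv A y₀ y₁ hy₀ N hN0]
      set s := (N:ℝ) * Real.exp (-p.1) with hsdef
      have e : f p * (A ^ 2 * Real.exp (-p.1) * (s * y₁ s ^ 2) * Real.sin (N * p.2) ^ 2) -
          f p * (A ^ 2 * Real.exp (-p.1) * ((1 / Real.pi) * (1 - Real.sin (2 * s)))
            * Real.sin (N * p.2) ^ 2) =
          f p * (A ^ 2 * Real.exp (-p.1) *
            (s * y₁ s ^ 2 - (1 / Real.pi) * (1 - Real.sin (2 * s))) * Real.sin (N * p.2) ^ 2) := by
        ring
      rw [e, norm_mul, mul_comm]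
      refine mul_le_mul_of_nonneg_right ?_ (norm_nonneg _)
      rw [Real.norm_eq_abs, abs_mul, abs_mul, abs_of_nonneg (sq_nonneg (Real.sin _)),
        abs_of_pos (by positivity : 0 < A ^ 2 * Real.exp (-p.1))]
      calc _ ≤ A ^ 2 * Real.exp (-p.1) * (C * (2 + C) / s) * 1 := by
            gcongr
            exact Real.sin_sq_le_one _
        _ = K / N := by
          rw [hK, hsdef]
          have := (Real.exp_pos (-p.1)).ne'
          field_simp
    have iM : Integrable (fun p : ℝ × ℝ => f p * (A ^ 2 * Real.exp (-p.1) * ((1 / Real.pi) *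
        (1 - Real.sin (2 * (N * Real.exp (-p.1))))) * Real.sin (N * p.2) ^ 2)) :=
      Continuous.integrable_of_hasCompactSupport (by fun_prop) hsupp.mul_right
    have hmeas : Measurable
        (fun p : ℝ × ℝ => f p * (deriv (fun t : ℝ => P_N A y₀ N t p.2) p.1) ^ 2) := by
      have e : (fun p : ℝ × ℝ => f p * (deriv (fun t : ℝ => P_N A y₀ N t p.2) p.1) ^ 2) =
          fun p : ℝ × ℝ => f p * (A ^ 2 * Real.exp (-p.1) * ((N * Real.exp (-p.1)) *
            (deriv y₀ (N * Real.exp (-p.1))) ^ 2) * Real.sin (N * p.2) ^ 2) := by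
        ext p
        rw [aux_deriv A y₀ y₁ hy₀ N hN0, (hy₀ (N * Real.exp (-p.1)) (by positivity)).deriv, neg_sq]
      rw [e]
      have hd := measurable_deriv y₀
      have hfm := hf.measurable
      fun_prop
    have iE := Integrable.mono' (hfi.norm.const_mul (K / N))
      ((hmeas.aestronglyMeasurable (μ := volume)).sub iM.aestronglyMeasurable) (ae_of_all _ hpt)
    have iD : Integrable
        (fun p : ℝ × ℝ => f p * (deriv (fun t : ℝ => P_N A y₀ N t p.2) p.1) ^ 2) := by
      refine (iE.add iM).congr (ae_of_all _ fun p => ?_)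
      simp
    rw [← integral_sub iD iM, ← integral_const_mul]
    exact norm_integral_le_of_norm_le (hfi.norm.const_mul (K / N)) (ae_of_all _ hpt)
  simpa using hdiff.add hM
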